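/- Let m be a positive integer, and let α, β, γ, δ, z_1, ..., z_m be commuting indeterminates with q := 1 + βγ − αδ. Then ∑_{r=1}^{m} ((−βδ)^{r−1} [r−1]! q^{−r(r−1)/2} / ∏_{p=0}^{r−1}(1 + βγ[m−1−p])) · e_r(z_1, q z_2, ..., q^{m−1} z_m) = (1/β) ∑_{r=1}^{m} ((−δ)^{r−1} [r−1]! / ∏_{p=1}^{r}(1 + βγ[p−1])) · ∑_{1≤b_1<⋯<b_r≤m} q^{∑_{p=1}^r (b_p − m)} ( ∏_{p=1}^{r}(α + β q^{p−1} z_{b_p}) − α^r ). -/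

import Mathlib

noncomputable section

/-- the field of rational functions over ℚ in indeterminates α, β, γ, δ and z_1, z_2, ... -/
abbrev K6 : Type := FractionRing (MvPolynomial (ℕ ⊕ Fin 4) ℚ)

def av : K6 := algebraMap (MvPolynomial (ℕ ⊕ Fin 4) ℚ) K6 (MvPolynomial.X (Sum.inr 0))
def bv : K6 := algebraMap (MvPolynomial (ℕ ⊕ Fin 4) ℚ) K6 (MvPolynomial.X (Sum.inr 1))
def cv : K6 := algebraMap (MvPolynomial (ℕ ⊕ Fin 4) ℚ) K6 (MvPolynomial.X (Sum.inr 2))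
def dv : K6 := algebraMap (MvPolynomial (ℕ ⊕ Fin 4) ℚ) K6 (MvPolynomial.X (Sum.inr 3))
/-- the indeterminate z_i -/
def zv (i : ℕ) : K6 := algebraMap (MvPolynomial (ℕ ⊕ Fin 4) ℚ) K6 (MvPolynomial.X (Sum.inl i))

/-- q := 1 + βγ − αδ -/
def qv : K6 := 1 + bv * cv - av * dv

/-- the q-integer [n] = (1 - q^n)/(1 - q) -/
def qint (n : ℕ) : K6 := (1 - qv ^ n) / (1 - qv)

/-- the q-factorial [k]! with [0]! = 1 -/
def qfact (k : ℕ) : K6 := ∏ a ∈ Finset.range k, qint (a + 1)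

section
variable {K : Type*} [Field K]

/-- The transform `∑_k f(s+k) α^k e_k(1,q⁻¹,...,q^{-(n-1)})`, defined recursively. -/
def auxA (q α : K) (f : ℕ → K) : ℕ → ℕ → K
  | 0, s => f s
  | n + 1, s => auxA q α f n s + α * (q ^ n)⁻¹ * auxA q α f n (s + 1)

lemma auxA_lin (q α c : K) (f g : ℕ → K) (n s : ℕ) :
    auxA q α (fun r => f r + c * g r) n s = auxA q α f n s + c * auxA q α g n s := by
  induction n generalizing s with
  | zero => rfl
  | succ n ih => simp only [auxA, ih]; ring

lemma auxA_shift (q α : K) (f : ℕ → K) (n s : ℕ) :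
    auxA q α (fun r => f (r + 1)) n s = auxA q α f n (s + 1) := by
  induction n generalizing s with
  | zero => rfl
  | succ n ih => simp only [auxA, ih]

lemma auxA_step (q α : K) (f : ℕ → K) (n s : ℕ) :
    auxA q α (fun r => (q ^ r)⁻¹ * (f r + α * f (r + 1))) n s
      = (q ^ s)⁻¹ * auxA q α f (n + 1) s := by
  induction n generalizing s with
  | zero => simp [auxA]
  | succ n ih =>
    rw [auxA, ih, ih, show auxA q α f (n + 1 + 1) s = auxA q α f (n + 1) s +
      α * (q ^ (n + 1))⁻¹ * auxA q α f (n + 1) (s + 1) from rfl]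
    simp only [pow_succ, mul_inv]
    ring

def auxR (q α β : K) (z : ℕ → K) (m : ℕ) (f : ℕ → K) : K :=
  ∑ B ∈ (Finset.Icc 1 m).powerset, f B.card * (q ^ (∑ b ∈ B, b) * (q ^ (B.card * m))⁻¹ *
    ∏ p ∈ Finset.range B.card, (α + β * q ^ p * z ((B.sort (· ≤ ·)).getD p 0)))

def auxL (q β : K) (z : ℕ → K) (m : ℕ) (g : ℕ → K) : K :=
  ∑ B ∈ (Finset.Icc 1 m).powerset, g B.card * ∏ i ∈ B, (q ^ i * (β * z i))

lemma aux_sort_insert (B : Finset ℕ) (m : ℕ) (h : ∀ b ∈ B, b < m) :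
    (insert m B).sort (· ≤ ·) = B.sort (· ≤ ·) ++ [m] := by
  have hm : m ∉ B := fun hh => lt_irrefl _ (h m hh)
  apply List.Perm.eq_of_pairwise' (r := (· ≤ ·))
  · exact Finset.pairwise_sort _ _
  · rw [List.pairwise_append]
    refine ⟨Finset.pairwise_sort _ _, by simp, ?_⟩
    intro a ha b hb
    simp at ha hb
    subst hb
    exact (h a ha).le
  · rw [List.perm_ext_iff_of_nodup (Finset.sort_nodup _ _)]
    · intro a; simp [or_comm]
    · rw [List.nodup_append]
      refine ⟨Finset.sort_nodup _ _, by simp, ?_⟩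
      intro a ha b hb
      simp at ha hb
      subst hb
      exact (h a ha).ne

lemma auxIcc (m : ℕ) : Finset.Icc 1 (m + 1) = insert (m + 1) (Finset.Icc 1 m) := by
  ext; simp; omega

lemma auxL_succ (q β : K) (z : ℕ → K) (m : ℕ) (g : ℕ → K) :
    auxL q β z (m + 1) g =
      auxL q β z m (fun s => g s + q ^ (m + 1) * (β * z (m + 1)) * g (s + 1)) := by
  unfold auxL
  rw [auxIcc, Finset.sum_powerset_insert (by simp), ← Finset.sum_add_distrib]
  refine Finset.sum_congr rfl fun B hB => ?_
  have hm : m + 1 ∉ B := fun hh => by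
    have := Finset.mem_Icc.1 (Finset.mem_powerset.1 hB hh); omega
  rw [Finset.card_insert_of_notMem hm, Finset.prod_insert hm]
  ring

lemma auxR_succ (q α β : K) (hq : q ≠ 0) (z : ℕ → K) (m : ℕ) (f : ℕ → K) :
    auxR q α β z (m + 1) f =
      auxR q α β z m (fun r => (q ^ r)⁻¹ * (f r + α * f (r + 1)) +
        β * z (m + 1) * f (r + 1)) := by
  unfold auxR
  rw [auxIcc, Finset.sum_powerset_insert (by simp), ← Finset.sum_add_distrib]
  refine Finset.sum_congr rfl fun B hB => ?_
  have hlt : ∀ b ∈ B, b < m + 1 := fun b hh => by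
    have := Finset.mem_Icc.1 (Finset.mem_powerset.1 hB hh); omega
  have hm : m + 1 ∉ B := fun hh => lt_irrefl _ (hlt _ hh)
  rw [Finset.card_insert_of_notMem hm, Finset.sum_insert hm, aux_sort_insert B _ hlt,
    Finset.prod_range_succ]
  have e1 : ∀ p ∈ Finset.range B.card,
      (α + β * q ^ p * z ((B.sort (· ≤ ·) ++ [m + 1]).getD p 0))
        = (α + β * q ^ p * z ((B.sort (· ≤ ·)).getD p 0)) := by
    intro p hp
    rw [List.getD_append _ _ _ _ (by simpa using hp)]
  rw [Finset.prod_congr rfl e1, List.getD_append_right _ _ _ _ (by simp)]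
  simp only [Finset.length_sort, Nat.sub_self, List.getD_cons_zero]
  have e2 : (B.card + 1) * (m + 1) = B.card * m + B.card + (m + 1) := by ring
  have e3 : B.card * (m + 1) = B.card * m + B.card := by ring
  rw [e2, e3]
  simp only [pow_add _ _ (m + 1), pow_add _ (m + 1), pow_add _ (B.card * m)]
  generalize ∏ p ∈ Finset.range B.card, (α + β * q ^ p * z ((B.sort (· ≤ ·)).getD p 0)) = P
  field_simp
  ring

/-- the transform of coefficient functions -/
def auxT (q α : K) (m : ℕ) (f : ℕ → K) (s : ℕ) : K :=
  q ^ (s * (s - 1) / 2) * (q ^ (s * m))⁻¹ * auxA q α f (m - s) s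

lemma auxL_congr (q β : K) (z : ℕ → K) (m : ℕ) (g h : ℕ → K) (H : ∀ s ≤ m, g s = h s) :
    auxL q β z m g = auxL q β z m h := by
  unfold auxL
  refine Finset.sum_congr rfl fun B hB => ?_
  have := Finset.card_le_card (Finset.mem_powerset.1 hB)
  rw [H _ (by simpa using this)]

lemma auxtri (s : ℕ) : (s + 1) * (s + 1 - 1) / 2 = s * (s - 1) / 2 + s := by
  have := Finset.sum_range_id s
  have h2 := Finset.sum_range_id (s + 1)
  rw [Finset.sum_range_succ] at h2
  omega

lemma auxT_succ (q α c : K) (hq : q ≠ 0) (m : ℕ) (f : ℕ → K) (s : ℕ) (hs : s ≤ m) :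
    auxT q α m (fun r => (q ^ r)⁻¹ * (f r + α * f (r + 1)) + c * f (r + 1)) s =
      auxT q α (m + 1) f s + q ^ (m + 1) * c * auxT q α (m + 1) f (s + 1) := by
  unfold auxT
  rw [auxA_lin, auxA_step, auxA_shift, auxtri, Nat.add_sub_add_right,
    show m + 1 - s = m - s + 1 by omega]
  have e2 : (s + 1) * (m + 1) = s * m + s + (m + 1) := by ring
  have e3 : s * (m + 1) = s * m + s := by ring
  rw [e2, e3]
  simp only [pow_add _ _ (m + 1), pow_add _ (s * m), pow_add _ _ s]
  field_simp

lemma auxR_eq_auxL (q α β : K) (hq : q ≠ 0) (z : ℕ → K) (m : ℕ) (f : ℕ → K) :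
    auxR q α β z m f = auxL q β z m (auxT q α m f) := by
  induction m generalizing f with
  | zero => simp [auxR, auxL, auxT, auxA]
  | succ m ih =>
    rw [auxR_succ _ _ _ hq, auxL_succ, ih]
    exact auxL_congr _ _ _ _ _ _ fun s hs => auxT_succ q α _ hq m f s hs

/-- closed form of the transform on the relevant coefficients -/
lemma auxA_closed (q α δ x : K) (Q : ℕ → K) (hQ : ∀ n, 1 + x * Q n ≠ 0)
    (hrel : ∀ n s, (1 + x * Q (n + s)) - α * δ * Q s = q ^ s * (1 + x * Q n))
    (hq : q ≠ 0) (f : ℕ → K)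
    (hf : ∀ s, f (s + 1) = (-δ) ^ s * (∏ a ∈ Finset.range s, Q (a + 1)) /
      ∏ p ∈ Finset.range (s + 1), (1 + x * Q p)) (n s : ℕ) :
    auxA q α f n (s + 1) = (-δ) ^ s * (∏ a ∈ Finset.range s, Q (a + 1)) * q ^ ((s + 1) * n) /
      ∏ p ∈ Finset.range (s + 1), (1 + x * Q (n + p)) := by
  induction n generalizing s with
  | zero => simp [auxA, hf]
  | succ n ih =>
    rw [auxA, ih, ih]
    have h := hrel n (s + 1)
    have e1 := Finset.prod_range_succ' (fun p => 1 + x * Q (n + p)) (s + 1)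
    have e2 := Finset.prod_range_succ (fun p => 1 + x * Q (n + p)) (s + 1)
    have e3 : ∏ p ∈ Finset.range (s + 1), (1 + x * Q (n + 1 + p)) =
        ∏ p ∈ Finset.range (s + 1), (1 + x * Q (n + (p + 1))) :=
      Finset.prod_congr rfl fun p _ => by rw [add_assoc, add_comm 1 p]
    have n1 : ∏ p ∈ Finset.range (s + 1), (1 + x * Q (n + p)) ≠ 0 :=
      Finset.prod_ne_zero_iff.2 fun p _ => hQ _
    have n2 : ∏ p ∈ Finset.range (s + 1), (1 + x * Q (n + (p + 1))) ≠ 0 :=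
      Finset.prod_ne_zero_iff.2 fun p _ => hQ _
    rw [e3, e2, Finset.prod_range_succ (fun a => Q (a + 1))]
    rw [e2] at e1
    simp only [add_zero] at e1
    have n3 := hQ (n + (s + 1))
    have n4 := hQ n
    generalize ∏ p ∈ Finset.range (s + 1), (1 + x * Q (n + p)) = P1 at *
    generalize ∏ p ∈ Finset.range (s + 1), (1 + x * Q (n + (p + 1))) = P2 at *
    generalize ∏ a ∈ Finset.range s, Q (a + 1) = F
    have k1 : q ^ ((s + 1 + 1) * n) = q ^ ((s + 1) * n) * q ^ n := by rw [← pow_add]; ring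
    have k2 : q ^ ((s + 1) * (n + 1)) = q ^ ((s + 1) * n) * q ^ (s + 1) := by
      rw [← pow_add]; ring
    rw [k1, k2, pow_succ (-δ)]
    generalize q ^ ((s + 1) * n) = w
    have n5 : q ^ n ≠ 0 := pow_ne_zero _ hq
    generalize q ^ n = y at *
    generalize q ^ (s + 1) = v at *
    generalize (-δ) ^ s = d
    generalize 1 + x * Q (n + (s + 1)) = A at *
    generalize 1 + x * Q n = C at *
    generalize Q (s + 1) = D at *
    have : d * F * w / P1 + α * y⁻¹ * (d * -δ * (F * D) * (w * y) / (P1 * A))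
        = d * F * w * (A - α * δ * D) / (P1 * A) := by
      field_simp
      ring
    rw [this, h, e1]
    field_simp


lemma aux_split (m : ℕ) (G : Finset ℕ → K) :
    ∑ B ∈ (Finset.Icc 1 m).powerset, G B =
      G ∅ + ∑ r ∈ Finset.Icc 1 m, ∑ B ∈ (Finset.Icc 1 m).powersetCard r, G B := by
  rw [Finset.sum_powerset, Finset.sum_range_succ', add_comm]
  congr 1
  · simp
  · rw [Nat.card_Icc, Nat.add_sub_cancel, Finset.range_eq_Ico,
      Finset.sum_Ico_add' (fun r => ∑ B ∈ (Finset.Icc 1 m).powersetCard r, G B) 0 m 1]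
    rfl

/-- The identity over a general field. -/
lemma aux_main (q α β δ x : K) (Q : ℕ → K) (hQ : ∀ n, 1 + x * Q n ≠ 0)
    (hrel : ∀ n s, (1 + x * Q (n + s)) - α * δ * Q s = q ^ s * (1 + x * Q n))
    (hq : q ≠ 0) (hβ : β ≠ 0) (z : ℕ → K) (m : ℕ) :
    ∑ r ∈ Finset.Icc 1 m,
      ((-(β * δ)) ^ (r - 1) * (∏ a ∈ Finset.range (r - 1), Q (a + 1)) *
          (q ^ (r * (r - 1) / 2))⁻¹ /
          ∏ p ∈ Finset.range r, (1 + x * Q (m - 1 - p))) *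
        ∑ T ∈ (Finset.Icc 1 m).powersetCard r, ∏ i ∈ T, q ^ (i - 1) * z i =
    β⁻¹ *
      ∑ r ∈ Finset.Icc 1 m,
        ((-δ) ^ (r - 1) * (∏ a ∈ Finset.range (r - 1), Q (a + 1)) /
            ∏ p ∈ Finset.Icc 1 r, (1 + x * Q (p - 1))) *
          ∑ B ∈ (Finset.Icc 1 m).powersetCard r,
            q ^ (∑ b ∈ B, b) * (q ^ (r * m))⁻¹ *
              ((∏ p ∈ Finset.range r,
                  (α + β * q ^ p * z ((B.sort (· ≤ ·)).getD p 0))) - α ^ r) := by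
  set f : ℕ → K := fun r => (-δ) ^ (r - 1) * (∏ a ∈ Finset.range (r - 1), Q (a + 1)) /
            ∏ p ∈ Finset.range r, (1 + x * Q p) with hf
  have hR : ∑ r ∈ Finset.Icc 1 m,
        ((-δ) ^ (r - 1) * (∏ a ∈ Finset.range (r - 1), Q (a + 1)) /
            ∏ p ∈ Finset.Icc 1 r, (1 + x * Q (p - 1))) *
          ∑ B ∈ (Finset.Icc 1 m).powersetCard r,
            q ^ (∑ b ∈ B, b) * (q ^ (r * m))⁻¹ *
              ((∏ p ∈ Finset.range r,
                  (α + β * q ^ p * z ((B.sort (· ≤ ·)).getD p 0))) - α ^ r)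
      = auxR q α β z m f - auxR q α 0 z m f := by
    unfold auxR
    rw [← Finset.sum_sub_distrib, aux_split]
    simp only [Finset.card_empty, Finset.range_zero, Finset.prod_empty, sub_self, zero_add]
    refine Finset.sum_congr rfl fun r _ => ?_
    rw [Finset.mul_sum]
    refine Finset.sum_congr rfl fun B hB => ?_
    rw [(Finset.mem_powersetCard.1 hB).2]
    have e : ∏ p ∈ Finset.Icc 1 r, (1 + x * Q (p - 1)) =
        ∏ p ∈ Finset.range r, (1 + x * Q p) := by
      rw [Finset.range_eq_Ico, ← Finset.Ico_add_one_right_eq_Icc]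
      have := Finset.prod_Ico_add' (fun p => 1 + x * Q (p - 1)) 0 r 1
      simpa using this.symm
    rw [e]
    simp only [hf, zero_mul, add_zero, Finset.prod_const, Finset.card_range]
    ring
  rw [hR, auxR_eq_auxL _ _ _ hq, auxR_eq_auxL _ _ _ hq]
  unfold auxL
  rw [← Finset.sum_sub_distrib, aux_split]
  simp only [Finset.card_empty, Finset.prod_empty, sub_self, zero_add]
  rw [Finset.mul_sum]
  refine Finset.sum_congr rfl fun r hr => ?_
  rw [Finset.mul_sum, Finset.mul_sum]
  refine Finset.sum_congr rfl fun B hB => ?_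
  obtain ⟨hBs, hBr⟩ := Finset.mem_powersetCard.1 hB
  rw [hBr]
  obtain ⟨hr1, hrm⟩ := Finset.mem_Icc.1 hr
  obtain ⟨s, rfl⟩ : ∃ s, r = s + 1 := ⟨r - 1, by omega⟩
  obtain ⟨n, rfl⟩ : ∃ n, m = n + (s + 1) := ⟨m - (s + 1), by omega⟩
  have hz : ∏ i ∈ B, q ^ i * (0 * z i) = 0 := by
    have : B.Nonempty := Finset.card_pos.1 (by omega)
    obtain ⟨b, hb⟩ := this
    exact Finset.prod_eq_zero hb (by simp)
  have hp : ∏ i ∈ B, q ^ i * (β * z i) =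
      q ^ (s + 1) * β ^ (s + 1) * ∏ i ∈ B, q ^ (i - 1) * z i := by
    rw [← hBr, ← Finset.prod_const, ← Finset.prod_const, ← Finset.prod_mul_distrib,
      ← Finset.prod_mul_distrib]
    refine Finset.prod_congr rfl fun i hi => ?_
    have := (Finset.mem_Icc.1 (hBs hi)).1
    obtain ⟨j, rfl⟩ : ∃ j, i = j + 1 := ⟨i - 1, by omega⟩
    rw [Nat.add_sub_cancel, pow_succ]
    ring
  rw [hz, hp]
  unfold auxT
  rw [show n + (s + 1) - (s + 1) = n by omega, auxA_closed q α δ x Q hQ hrel hq f (fun s => rfl)]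
  have hrefl : ∏ p ∈ Finset.range (s + 1), (1 + x * Q (n + (s + 1) - 1 - p)) =
      ∏ p ∈ Finset.range (s + 1), (1 + x * Q (n + p)) := by
    rw [← Finset.prod_range_reflect]
    refine Finset.prod_congr rfl fun p hp => ?_
    have := Finset.mem_range.1 hp
    congr 3
    omega
  rw [hrefl]
  have n1 : ∏ p ∈ Finset.range (s + 1), (1 + x * Q (n + p)) ≠ 0 :=
      Finset.prod_ne_zero_iff.2 fun p _ => hQ _
  generalize ∏ p ∈ Finset.range (s + 1), (1 + x * Q (n + p)) = P at *
  generalize ∏ i ∈ B, q ^ (i - 1) * z i = Z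
  simp only [Nat.add_sub_cancel]
  generalize ∏ a ∈ Finset.range s, Q (a + 1) = F
  have ht : (s + 1) * s / 2 * 2 = (s + 1) * s :=
    Nat.div_mul_cancel (by have := Nat.even_mul_succ_self s; rw [mul_comm]; exact this.two_dvd)
  generalize (s + 1) * s / 2 = t at *
  have hx : q ^ ((s + 1) * (n + (s + 1))) = q ^ t * q ^ t * q ^ ((s + 1) * n) * q ^ (s + 1) := by
    rw [← pow_add, ← pow_add, ← pow_add]
    congr 1
    nlinarith
  rw [hx, neg_mul_eq_mul_neg, mul_pow, pow_succ β]
  field_simp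
  ring

end

/-- the embedding of polynomials into the field -/
abbrev emb6 : MvPolynomial (ℕ ⊕ Fin 4) ℚ →+* K6 := algebraMap (MvPolynomial (ℕ ⊕ Fin 4) ℚ) K6

lemma emb6_ne (P : MvPolynomial (ℕ ⊕ Fin 4) ℚ) (v : ℕ ⊕ Fin 4 → ℚ)
    (h : MvPolynomial.eval v P ≠ 0) : emb6 P ≠ 0 := by
  intro h0
  have : P = 0 := (IsFractionRing.injective (MvPolynomial (ℕ ⊕ Fin 4) ℚ) K6) (by
    rw [map_zero]; exact h0)
  exact h (by rw [this, map_zero])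

/-- the polynomial q -/
def qpoly : MvPolynomial (ℕ ⊕ Fin 4) ℚ :=
  1 + MvPolynomial.X (Sum.inr 1) * MvPolynomial.X (Sum.inr 2) -
    MvPolynomial.X (Sum.inr 0) * MvPolynomial.X (Sum.inr 3)

lemma qv_eq : qv = emb6 qpoly := by
  simp only [qv, qpoly, av, bv, cv, dv, map_add, map_sub, map_mul, map_one]

lemma qv_ne : qv ≠ 0 := by
  rw [qv_eq]
  exact emb6_ne _ (fun _ => 0) (by simp [qpoly])

lemma qv_ne_one : 1 - qv ≠ 0 := by
  have : 1 - qv = emb6 (1 - qpoly) := by rw [qv_eq, map_sub, map_one]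
  rw [this]
  exact emb6_ne _ (fun i => if i = Sum.inr 0 ∨ i = Sum.inr 3 then 1 else 0) (by simp [qpoly])

lemma bv_ne : bv ≠ 0 := emb6_ne _ (fun _ => 1) (by simp)

lemma qint_eq (n : ℕ) : qint n = ∑ i ∈ Finset.range n, qv ^ i := by
  rw [qint, div_eq_iff qv_ne_one, geom_sum_mul_neg]

lemma den_ne (n : ℕ) : 1 + bv * cv * qint n ≠ 0 := by
  have : 1 + bv * cv * qint n = emb6 (1 + MvPolynomial.X (Sum.inr 1) *
      MvPolynomial.X (Sum.inr 2) * ∑ i ∈ Finset.range n, qpoly ^ i) := by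
    rw [qint_eq, qv_eq]
    simp only [bv, cv, map_add, map_mul, map_one, map_sum, map_pow]
  rw [this]
  exact emb6_ne _ (fun _ => 0) (by simp)

lemma rel6 (n s : ℕ) : (1 + bv * cv * qint (n + s)) - av * dv * qint s =
    qv ^ s * (1 + bv * cv * qint n) := by
  have h : av * dv = bv * cv + (1 - qv) := by rw [qv]; ring
  have h1 := qv_ne_one
  rw [h]
  unfold qint
  field_simp
  ring

/-- Lemma: rewriting of the Hamiltonian, first identity:
∑_{r=1}^{m} ((−βδ)^{r−1} [r−1]! q^{−r(r−1)/2} / ∏_{p=0}^{r−1}(1+βγ[m−1−p]))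
  e_r(z_1, q z_2, ..., q^{m−1} z_m)
 = (1/β) ∑_{r=1}^{m} ((−δ)^{r−1} [r−1]! / ∏_{p=1}^{r}(1+βγ[p−1]))
   ∑_{1≤b_1<⋯<b_r≤m} q^{∑_p (b_p − m)} (∏_{p=1}^{r}(α + β q^{p−1} z_{b_p}) − α^r). -/
theorem stmt6 (m : ℕ) (hm : 0 < m) :
    ∑ r ∈ Finset.Icc 1 m,
      ((-(bv * dv)) ^ (r - 1) * qfact (r - 1) * (qv ^ (r * (r - 1) / 2))⁻¹ /
          ∏ p ∈ Finset.range r, (1 + bv * cv * qint (m - 1 - p))) *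
        ∑ T ∈ (Finset.Icc 1 m).powersetCard r, ∏ i ∈ T, qv ^ (i - 1) * zv i =
    bv⁻¹ *
      ∑ r ∈ Finset.Icc 1 m,
        ((-dv) ^ (r - 1) * qfact (r - 1) /
            ∏ p ∈ Finset.Icc 1 r, (1 + bv * cv * qint (p - 1))) *
          ∑ B ∈ (Finset.Icc 1 m).powersetCard r,
            qv ^ (∑ b ∈ B, b) * (qv ^ (r * m))⁻¹ *
              ((∏ p ∈ Finset.range r,
                  (av + bv * qv ^ p * zv ((B.sort (· ≤ ·)).getD p 0))) - av ^ r) := by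
  exact aux_main qv av bv dv (bv * cv) qint den_ne rel6 qv_ne bv_ne zv m

end
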